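/- Let σ > 0 and ρ₀ ∈ (-1,1) be constants and set σᵇ(z) = σᵃ(z) = σ and ρ(z) = ρ₀ for all z. Then the formula u(z) = (∫₀^z exp(-∫₀^y μ(x)/ν(x) dx) dy) / (∫₀^1 exp(-∫₀^y μ(x)/ν(x) dx) dy) satisfies u(z) = (1/2)·[1 - arctan(β·(1-2z)) / arctan(β)] for all z ∈ [0,1], where β = √((1+ρ₀)/(1-ρ₀)). (This is the correlated Brownian motion price-movement probability of Avellaneda et al. as a special case of Theorem 3.2.) -/

import Mathlib

open Real Set

/-- Drift coefficient μ(z) of the imbalance ODE. -/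
noncomputable def mu (σb σa ρ : ℝ → ℝ) (z : ℝ) : ℝ :=
  -2 * (1 - z) * (σb z) ^ 2 + 2 * (2 * z - 1) * ρ z * σb z * σa z + 2 * z * (σa z) ^ 2

/-- Diffusion coefficient ν(z) of the imbalance ODE. -/
noncomputable def nu (σb σa ρ : ℝ → ℝ) (z : ℝ) : ℝ :=
  (1 - z) ^ 2 * (σb z) ^ 2 - 2 * z * (1 - z) * ρ z * σb z * σa z + z ^ 2 * (σa z) ^ 2
theorem nu_const (s r z : ℝ) :
    nu (fun _ => s) (fun _ => s) (fun _ => r) z = s ^ 2 * (1 - 2 * (1 + r) * (z * (1 - z))) := by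
  simp only [nu]
  ring

/-- For constant volatility and correlation, the drift coefficient is the derivative of the
diffusion coefficient. -/
theorem hasDerivAt_nu_const (s r z : ℝ) :
    HasDerivAt (nu (fun _ => s) (fun _ => s) (fun _ => r))
      (mu (fun _ => s) (fun _ => s) (fun _ => r) z) z := by
  have h : HasDerivAt (fun z : ℝ => s ^ 2 * (1 - 2 * (1 + r) * (z * (1 - z))))
      (s ^ 2 * (-(2 * (1 + r) * (1 * (1 - z) + z * (-1))))) z :=
    ((((hasDerivAt_id z).mul ((hasDerivAt_id z).const_sub 1)).const_mul
      (2 * (1 + r))).const_sub 1).const_mul (s ^ 2)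
  rw [funext (nu_const s r)]
  convert h using 1
  simp only [mu]
  ring

theorem nu_const_eq_arctan_denom {s r : ℝ} (hr : r ∈ Ioo (-1 : ℝ) 1) (z : ℝ) :
    nu (fun _ => s) (fun _ => s) (fun _ => r) z =
      s ^ 2 * ((1 - r) / 2 * (1 + (√((1 + r) / (1 - r)) * (1 - 2 * z)) ^ 2)) := by
  have h1 : 0 < 1 + r := by linarith [hr.1]
  have h2 : 0 < 1 - r := by linarith [hr.2]
  rw [nu_const, mul_pow, Real.sq_sqrt (by positivity)]
  field_simp
  ring

theorem nu_const_pos {s r : ℝ} (hs : 0 < s) (hr : r ∈ Ioo (-1 : ℝ) 1) (z : ℝ) :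
    0 < nu (fun _ => s) (fun _ => s) (fun _ => r) z := by
  have h2 : 0 < 1 - r := by linarith [hr.2]
  rw [nu_const_eq_arctan_denom hr]
  positivity

theorem exp_neg_integral_mu_div_nu_const {s r : ℝ} (hs : 0 < s) (hr : r ∈ Ioo (-1 : ℝ) 1)
    (y : ℝ) :
    Real.exp (-∫ x in (0 : ℝ)..y, mu (fun _ => s) (fun _ => s) (fun _ => r) x /
      nu (fun _ => s) (fun _ => s) (fun _ => r) x) =
      s ^ 2 / nu (fun _ => s) (fun _ => s) (fun _ => r) y := by
  have hpos := nu_const_pos hs hr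
  have hcont : Continuous fun x => mu (fun _ => s) (fun _ => s) (fun _ => r) x /
      nu (fun _ => s) (fun _ => s) (fun _ => r) x := by
    refine Continuous.div ?_ ?_ fun x => (hpos x).ne'
    · unfold mu
      fun_prop
    · unfold nu
      fun_prop
  rw [intervalIntegral.integral_eq_sub_of_hasDerivAt
    (fun x _ => (hasDerivAt_nu_const s r x).log (hpos x).ne') (hcont.intervalIntegrable 0 y),
    neg_sub, Real.exp_sub, Real.exp_log (hpos 0), Real.exp_log (hpos y)]
  congr 1
  simp [nu]

theorem integral_exp_neg_integral_mu_div_nu_const {s r : ℝ} (hs : 0 < s)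
    (hr : r ∈ Ioo (-1 : ℝ) 1) (z : ℝ) :
    ∫ y in (0 : ℝ)..z, Real.exp (-∫ x in (0 : ℝ)..y,
      mu (fun _ => s) (fun _ => s) (fun _ => r) x /
      nu (fun _ => s) (fun _ => s) (fun _ => r) x) =
      (arctan √((1 + r) / (1 - r)) - arctan (√((1 + r) / (1 - r)) * (1 - 2 * z))) /
        (√((1 + r) / (1 - r)) * (1 - r)) := by
  have h1 : 0 < 1 + r := by linarith [hr.1]
  have h2 : 0 < 1 - r := by linarith [hr.2]
  have hb : 0 < √((1 + r) / (1 - r)) := Real.sqrt_pos.2 (by positivity)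
  have hpos := nu_const_pos hs hr
  have hcont : Continuous fun y => s ^ 2 / nu (fun _ => s) (fun _ => s) (fun _ => r) y := by
    refine continuous_const.div ?_ fun x => (hpos x).ne'
    unfold nu
    fun_prop
  have hden := nu_const_eq_arctan_denom (s := s) hr
  simp only [exp_neg_integral_mu_div_nu_const hs hr]
  set b := √((1 + r) / (1 - r))
  have hderiv (y : ℝ) : HasDerivAt (fun y => -arctan (b * (1 - 2 * y)) / (b * (1 - r)))
      (s ^ 2 / nu (fun _ => s) (fun _ => s) (fun _ => r) y) y := by
    have h := ((((((hasDerivAt_id' y).const_mul 2).const_sub 1).const_mul b).arctan).neg).div_const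
      (b * (1 - r))
    refine h.congr_deriv ?_
    have : 0 < 1 + (b * (1 - 2 * y)) ^ 2 := by positivity
    rw [hden]
    field_simp
  rw [intervalIntegral.integral_eq_sub_of_hasDerivAt (fun y _ => hderiv y)
    (hcont.intervalIntegrable 0 z)]
  simp only [mul_zero, sub_zero, mul_one]
  ring

theorem stmt_7 (σ ρ₀ : ℝ) (hσ : 0 < σ) (hρ₀ : ρ₀ ∈ Ioo (-1 : ℝ) 1)
    (u : ℝ → ℝ)
    (hu : ∀ z : ℝ, u z =
      (∫ y in (0:ℝ)..z, Real.exp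
        (-∫ x in (0:ℝ)..y,
          mu (fun _ => σ) (fun _ => σ) (fun _ => ρ₀) x /
          nu (fun _ => σ) (fun _ => σ) (fun _ => ρ₀) x)) /
      (∫ y in (0:ℝ)..(1:ℝ), Real.exp
        (-∫ x in (0:ℝ)..y,
          mu (fun _ => σ) (fun _ => σ) (fun _ => ρ₀) x /
          nu (fun _ => σ) (fun _ => σ) (fun _ => ρ₀) x))) :
    ∀ z ∈ Icc (0:ℝ) 1,
      u z = (1 / 2) * (1 - Real.arctan (Real.sqrt ((1 + ρ₀) / (1 - ρ₀)) * (1 - 2 * z)) /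
        Real.arctan (Real.sqrt ((1 + ρ₀) / (1 - ρ₀)))) := by
  intro z _
  have h1 : 0 < 1 + ρ₀ := by linarith [hρ₀.1]
  have h2 : 0 < 1 - ρ₀ := by linarith [hρ₀.2]
  have hb : 0 < √((1 + ρ₀) / (1 - ρ₀)) := Real.sqrt_pos.2 (by positivity)
  rw [hu, integral_exp_neg_integral_mu_div_nu_const hσ hρ₀,
    integral_exp_neg_integral_mu_div_nu_const hσ hρ₀]
  set b := √((1 + ρ₀) / (1 - ρ₀))
  have ha : 0 < arctan b := Real.arctan_pos.2 hb
  have hone : arctan (b * (1 - 2 * 1)) = -arctan b := by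
    rw [← Real.arctan_neg]
    congr 1
    ring
  rw [hone, sub_neg_eq_add, ← two_mul]
  field_simp
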